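/- arXiv:2504.03477 — 2 statements merged into one kernel-verified Lean document; each statement's English description precedes it below -/
import Mathlib

section
/- Let PN be a Petri net, q0 a marking, t ∈ T a transition, and f ∈ F⁺ a nonzero semiflow with nonnegative coordinates such that fᵀq0 < fᵀPre(·,t). Then no marking reachable from q0 enables t; in particular, t can never be executed starting from ⟨PN,q0⟩. -/
namespace PetriNetFormal

variable {P T : Type*}

/-- The marking obtained by firing transition `t` at marking `q`. -/
def fire (Pre Post : P → T → ℕ) (t : T) (q : P → ℕ) : P → ℕ :=
  fun p => q p - Pre p t + Post p t

/-- Transition `t` is enabled at marking `q`. -/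
def enabled (Pre : P → T → ℕ) (q : P → ℕ) (t : T) : Prop :=
  ∀ p, Pre p t ≤ q p

/-- One firing step between markings. -/
def step (Pre Post : P → T → ℕ) (q q' : P → ℕ) : Prop :=
  ∃ t, enabled Pre q t ∧ q' = fire Pre Post t q

/-- Reachability: `q'` is obtained from `q` by firing a finite sequence of transitions. -/
def reach (Pre Post : P → T → ℕ) : (P → ℕ) → (P → ℕ) → Prop :=
  Relation.ReflTransGen (step Pre Post)

/-- A semiflow takes the same value on all reachable markings. -/
theorem sum_semiflow_eq_of_reach [Fintype P] {Pre Post : P → T → ℕ} {f : P → ℤ}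
    (hsemi : ∀ t : T, ∑ p, f p * (Post p t : ℤ) = ∑ p, f p * (Pre p t : ℤ))
    {q q' : P → ℕ} (h : reach Pre Post q q') :
    ∑ p, f p * (q' p : ℤ) = ∑ p, f p * (q p : ℤ) := by
  induction h with
  | refl => rfl
  | tail _ hstep ih =>
    obtain ⟨t, hen, rfl⟩ := hstep
    rw [← ih]
    simp only [fire, Nat.cast_add, Nat.cast_sub (hen _), mul_add, mul_sub,
      Finset.sum_add_distrib, Finset.sum_sub_distrib, hsemi t]
    ring

/-- If `f ∈ F⁺` is a nonzero semiflow with nonnegative coordinates and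
`fᵀq0 < fᵀPre(·,t)`, then no marking reachable from `q0` enables `t`. -/
theorem enabling_threshold_never_reached [Fintype P]
    (Pre Post : P → T → ℕ) (q0 : P → ℕ) (t : T) (f : P → ℤ)
    (hsemi : ∀ t' : T, ∑ p, f p * (Post p t' : ℤ) = ∑ p, f p * (Pre p t' : ℤ))
    (hnonneg : ∀ p, 0 ≤ f p) (hne : f ≠ 0)
    (hthr : ∑ p, f p * (q0 p : ℤ) < ∑ p, f p * (Pre p t : ℤ)) :
    ∀ q : P → ℕ, reach Pre Post q0 q → ¬ enabled Pre q t := by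
  intro q hq hen
  rw [← sum_semiflow_eq_of_reach hsemi hq] at hthr
  refine hthr.not_ge (Finset.sum_le_sum fun p _ => ?_)
  exact mul_le_mul_of_nonneg_left (Nat.cast_le.mpr (hen p)) (hnonneg p)

end PetriNetFormal
end

section
/- Let PN be a Petri net and Init a nonempty set of markings such that RS(PN,Init) is finite, and suppose S is the unique strongly connected component sink of RG(PN,Init). Then S is an Init-home space, and a marking s is an Init-home state if and only if s ∈ S. -/
namespace PetriNetFormal

variable {P T : Type*}

/-- The reachability set from a set `Init` of initial markings. -/
def RS (Pre Post : P → T → ℕ) (Init : Set (P → ℕ)) : Set (P → ℕ) :=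
  {q | ∃ a ∈ Init, reach Pre Post a q}

/-- `H` is an `Init`-home space. -/
def homeSpace (Pre Post : P → T → ℕ) (Init H : Set (P → ℕ)) : Prop :=
  ∀ q ∈ RS Pre Post Init, ∃ h ∈ H, reach Pre Post q h

/-- `s` is an `Init`-home state. -/
def homeState (Pre Post : P → T → ℕ) (Init : Set (P → ℕ)) (s : P → ℕ) : Prop :=
  homeSpace Pre Post Init {s}

/-- `S` is a strongly connected component sink of `RG(PN,Init)`: an equivalence class
of the mutual-reachability relation on `RS(PN,Init)` that is closed under reachability. -/
def sccSink (Pre Post : P → T → ℕ) (Init : Set (P → ℕ)) (S : Set (P → ℕ)) : Prop :=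
  (∃ x ∈ RS Pre Post Init,
    S = {y ∈ RS Pre Post Init | reach Pre Post x y ∧ reach Pre Post y x}) ∧
  (∀ y ∈ S, ∀ z, reach Pre Post y z → z ∈ S)

/-- Transition `t` is live in `⟨PN, Init⟩`. -/
def live (Pre Post : P → T → ℕ) (Init : Set (P → ℕ)) (t : T) : Prop :=
  ∀ q ∈ RS Pre Post Init, ∃ q', reach Pre Post q q' ∧ enabled Pre q' t

/-- If only finitely many elements are reachable from `a`, then some element reachable from `a`
is reachable from all of its own successors. -/
theorem exists_reflTransGen_recurrent {α : Type*} {r : α → α → Prop} {a : α}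
    (hfin : {b | Relation.ReflTransGen r a b}.Finite) :
    ∃ b, Relation.ReflTransGen r a b ∧
      ∀ c, Relation.ReflTransGen r b c → Relation.ReflTransGen r c b := by
  obtain ⟨b, hab, hmin⟩ := hfin.exists_minimalFor
    (fun b => {c | Relation.ReflTransGen r b c}) _ ⟨a, Relation.ReflTransGen.refl⟩
  refine ⟨b, hab, fun c hbc => ?_⟩
  exact hmin (j := c) (hab.trans hbc) (fun d hcd => hbc.trans hcd) Relation.ReflTransGen.refl

/-- The reachability set is closed under reachability. -/
theorem RS_of_reach {Pre Post : P → T → ℕ} {Init : Set (P → ℕ)} {q q' : P → ℕ}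
    (hq : q ∈ RS Pre Post Init) (h : reach Pre Post q q') : q' ∈ RS Pre Post Init := by
  obtain ⟨a, ha, haq⟩ := hq
  exact ⟨a, ha, haq.trans h⟩

/-- In a finite reachability graph, every reachable marking can reach an element of some strongly
connected component sink. -/
theorem exists_sccSink_of_finite {Pre Post : P → T → ℕ} {Init : Set (P → ℕ)}
    (hfin : (RS Pre Post Init).Finite) {q : P → ℕ} (hq : q ∈ RS Pre Post Init) :
    ∃ S, sccSink Pre Post Init S ∧ ∃ h ∈ S, reach Pre Post q h := by
  obtain ⟨m, hqm, hm⟩ := exists_reflTransGen_recurrent (r := step Pre Post) (a := q)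
    (hfin.subset fun _ h => RS_of_reach hq h)
  have hmRS := RS_of_reach hq hqm
  refine ⟨_, ⟨⟨m, hmRS, rfl⟩, ?_⟩, m,
    ⟨hmRS, Relation.ReflTransGen.refl, Relation.ReflTransGen.refl⟩, hqm⟩
  rintro y ⟨hy, hmy, -⟩ z hyz
  exact ⟨RS_of_reach hy hyz, hmy.trans hyz, hm z (hmy.trans hyz)⟩

/-- if `RS(PN,Init)` is finite and `S` is the unique strongly connected
component sink of `RG(PN,Init)`, then `S` is an `Init`-home space, and a marking is an
`Init`-home state iff it belongs to `S`. -/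
theorem unique_scc_sink_home_space
    (Pre Post : P → T → ℕ) (Init : Set (P → ℕ)) (hInit : Init.Nonempty)
    (hfin : (RS Pre Post Init).Finite)
    (S : Set (P → ℕ)) (hS : sccSink Pre Post Init S)
    (huniq : ∀ S' : Set (P → ℕ), sccSink Pre Post Init S' → S' = S) :
    homeSpace Pre Post Init S ∧
    (∀ s : P → ℕ, homeState Pre Post Init s ↔ s ∈ S) := by
  have hhome : homeSpace Pre Post Init S := by
    intro q hq
    obtain ⟨S', hS', h⟩ := exists_sccSink_of_finite hfin hq
    exact huniq S' hS' ▸ h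
  refine ⟨hhome, fun s => ⟨fun hs => ?_, fun hs q hq => ?_⟩⟩
  · obtain ⟨⟨x, hx, rfl⟩, hclosed⟩ := hS
    obtain ⟨_, rfl, hxs⟩ := hs x hx
    exact hclosed x ⟨hx, Relation.ReflTransGen.refl, Relation.ReflTransGen.refl⟩ _ hxs
  · obtain ⟨h, hhS, hqh⟩ := hhome q hq
    obtain ⟨⟨x, -, rfl⟩, -⟩ := hS
    exact ⟨s, rfl, hqh.trans (hhS.2.2.trans hs.2.1)⟩

end PetriNetFormal
end
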